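/- Let Ω ⊂ ℝⁿ be a bounded open set, u : Ω → ℝ bounded and lower semicontinuous, q > 2 and ε > 0. Suppose that at a point x₀ ∈ Ω_{r(ε)} the infimal convolution u_ε admits a second-order expansion with gradient w ∈ ℝⁿ and symmetric Hessian matrix A (i.e. u_ε(y) = u_ε(x₀) + ⟨w, y−x₀⟩ + (1/2)⟨A(y−x₀), y−x₀⟩ + o(|y−x₀|²) as y → x₀), and that w = 0. Then A is negative semidefinite: ⟨Aξ, ξ⟩ ≤ 0 for every ξ ∈ ℝⁿ. -/

import Mathlib

open MeasureTheory Metric Set Filter Asymptotics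
open scoped RealInnerProductSpace NNReal Topology

noncomputable section

abbrev En (n : ℕ) := EuclideanSpace ℝ (Fin n)

/-- The nondivergence-form `p(·)`-Laplacian `-Δ_{p(·)} φ` at `x`. -/
noncomputable def negPLap {n : ℕ} (p φ : En n → ℝ) (x : En n) : ℝ :=
  -(‖gradient φ x‖ ^ (p x - 2) *
      LinearMap.trace ℝ (En n) (fderiv ℝ (gradient φ) x : En n →ₗ[ℝ] En n))
  - (p x - 2) * ‖gradient φ x‖ ^ (p x - 4) *
      ⟪fderiv ℝ (gradient φ) x (gradient φ x), gradient φ x⟫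
  - ‖gradient φ x‖ ^ (p x - 2) * Real.log ‖gradient φ x‖ *
      ⟪gradient p x, gradient φ x⟫

/-- `u` is a viscosity supersolution of `-Δ_{p(·)} u = 0` on an open set `D`. -/
def IsViscositySupersolution {n : ℕ} (p u : En n → ℝ) (D : Set (En n)) : Prop :=
  ∀ x₀ ∈ D, ∀ φ : En n → ℝ,
    ContDiffAt ℝ 2 φ x₀ → φ x₀ = u x₀ →
    (∀ᶠ x in 𝓝[≠] x₀, φ x < u x) →
    gradient φ x₀ ≠ 0 → 0 ≤ negPLap p φ x₀

/-- The infimal convolution `u_ε` of `u`. -/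
noncomputable def infConv {n : ℕ} (u : En n → ℝ) (Ω : Set (En n)) (q ε : ℝ) (x : En n) : ℝ :=
  sInf ((fun y => u y + ‖x - y‖ ^ q / (q * ε ^ (q - 1))) '' Ω)

/-- `r(ε) = (q ε^{q-1} (M - m))^{1/q}` where `M = sup u`, `m = inf u`. -/
noncomputable def rEps {n : ℕ} (u : En n → ℝ) (Ω : Set (En n)) (q ε : ℝ) : ℝ :=
  (q * ε ^ (q - 1) * (sSup (u '' Ω) - sInf (u '' Ω))) ^ (1 / q)

/-- `Ω_r = {x ∈ Ω : dist(x, ∂Ω) > r}`. -/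
def innerSet {n : ℕ} (Ω : Set (En n)) (r : ℝ) : Set (En n) :=
  {x ∈ Ω | r < Metric.infDist x (frontier Ω)}

/-- The set of minimizers `Y_ε(x)`. -/
def Yset {n : ℕ} (u : En n → ℝ) (Ω : Set (En n)) (q ε : ℝ) (x : En n) : Set (En n) :=
  {y ∈ Ω | infConv u Ω q ε x = u y + ‖x - y‖ ^ q / (q * ε ^ (q - 1))}

/-- `f` is locally Lipschitz on `s`. -/
def LocLipschitzOn {n : ℕ} (f : En n → ℝ) (s : Set (En n)) : Prop :=
  ∀ x ∈ s, ∃ K : ℝ≥0, ∃ t ∈ 𝓝[s] x, LipschitzOnWith K f t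

open Classical in
/-- `|Du(x)|^{p(x)-2} ⟨Du(x), Dψ(x)⟩`, taken to be `0` where `Du(x) = 0`. -/
noncomputable def weakIntegrand {n : ℕ} (p u ψ : En n → ℝ) (x : En n) : ℝ :=
  if gradient u x = 0 then 0
  else ‖gradient u x‖ ^ (p x - 2) * ⟪gradient u x, gradient ψ x⟫


/-- Quadratic difference quotients of a function with a second-order expansion with zero
gradient converge to half the quadratic form. -/
theorem tendsto_quotient_of_expansion {E : Type*} [NormedAddCommGroup E] [InnerProductSpace ℝ E]
    {f : E → ℝ} {x₀ : E} {A : E →L[ℝ] E}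
    (hexp : (fun y => f y - (f x₀ + (1 / 2) * ⟪A (y - x₀), y - x₀⟫))
      =o[𝓝 x₀] fun y => ‖y - x₀‖ ^ 2) (ξ : E) :
    Tendsto (fun t : ℝ => (f (x₀ + t • ξ) - f x₀) / t ^ 2) (𝓝[>] 0)
      (𝓝 ((1 / 2) * ⟪A ξ, ξ⟫)) := by
  have hline : Tendsto (fun t : ℝ => x₀ + t • ξ) (𝓝[>] 0) (𝓝 x₀) := by
    have : Continuous fun t : ℝ => x₀ + t • ξ := by fun_prop
    simpa using (this.tendsto 0).mono_left nhdsWithin_le_nhds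
  have hcomp := hexp.comp_tendsto hline
  have hO : ((fun y => ‖y - x₀‖ ^ 2) ∘ fun t : ℝ => x₀ + t • ξ) =O[𝓝[>] 0]
      fun t : ℝ => t ^ 2 := by
    refine IsBigO.of_bound (‖ξ‖ ^ 2) (Eventually.of_forall fun t => ?_)
    simp [norm_smul, mul_pow, mul_comm]
  have hlim := (hcomp.trans_isBigO hO).tendsto_div_nhds_zero.add_const ((1 / 2) * ⟪A ξ, ξ⟫)
  rw [zero_add] at hlim
  refine hlim.congr' ?_
  filter_upwards [self_mem_nhdsWithin] with t ht
  have ht0 : t ≠ 0 := ne_of_gt ht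
  simp only [Function.comp, add_sub_cancel_left, map_smul, inner_smul_left, inner_smul_right,
    conj_trivial]
  field_simp
  ring

/-- The infimal convolution lies below each function over which the infimum is taken. -/
theorem infConv_le {n : ℕ} {u : En n → ℝ} {Ω : Set (En n)} {q ε : ℝ}
    (hbddB : BddBelow (u '' Ω)) (hq : 0 < q) (hε : 0 < ε) {y : En n} (hy : y ∈ Ω) (x : En n) :
    infConv u Ω q ε x ≤ u y + ‖x - y‖ ^ q / (q * ε ^ (q - 1)) := by
  refine csInf_le ?_ (mem_image_of_mem _ hy)
  obtain ⟨m, hm⟩ := hbddB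
  refine ⟨m, ?_⟩
  rintro _ ⟨z, hz, rfl⟩
  have h₁ : m ≤ u z := hm (mem_image_of_mem _ hz)
  have h₂ : 0 ≤ ‖x - z‖ ^ q / (q * ε ^ (q - 1)) := by positivity
  show m ≤ u z + ‖x - z‖ ^ q / (q * ε ^ (q - 1))
  linarith

/-- A point whose distance to the frontier exceeds `r` has its closed `r`-ball inside the set. -/
theorem closedBall_subset_of_mem_innerSet {n : ℕ} {Ω : Set (En n)} {r : ℝ} {x : En n}
    (hx : x ∈ innerSet Ω r) : closedBall x r ⊆ Ω := by
  obtain ⟨hxΩ, hlt⟩ := hx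
  intro y hy
  by_contra hyΩ
  obtain ⟨z, hz, hdist⟩ := exists_mem_frontier_infDist_compl_eq_dist hxΩ
    ((ne_univ_iff_exists_notMem Ω).mpr ⟨y, hyΩ⟩)
  have h₁ : infDist x (frontier Ω) ≤ dist x z := infDist_le_dist_of_mem hz
  have h₂ : infDist x Ωᶜ ≤ dist x y := infDist_le_dist_of_mem hyΩ
  rw [mem_closedBall, dist_comm] at hy
  linarith

/-- The infimum in the infimal convolution is attained at points of `Ω_{r(ε)}`. -/
theorem Yset_nonempty {n : ℕ} {u : En n → ℝ} {Ω : Set (En n)} {q ε : ℝ}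
    (hbddA : BddAbove (u '' Ω)) (hbddB : BddBelow (u '' Ω)) (hlsc : LowerSemicontinuousOn u Ω)
    (hq : 0 < q) (hε : 0 < ε) {x : En n} (hx : x ∈ innerSet Ω (rEps u Ω q ε)) :
    (Yset u Ω q ε x).Nonempty := by
  have hxΩ : x ∈ Ω := hx.1
  have hc : 0 < q * ε ^ (q - 1) := by positivity
  have hxM : u x ≤ sSup (u '' Ω) := le_csSup hbddA (mem_image_of_mem _ hxΩ)
  have hmx : sInf (u '' Ω) ≤ u x := csInf_le hbddB (mem_image_of_mem _ hxΩ)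
  have hosc : 0 ≤ q * ε ^ (q - 1) * (sSup (u '' Ω) - sInf (u '' Ω)) :=
    mul_nonneg hc.le (by linarith)
  have hr : 0 ≤ rEps u Ω q ε := Real.rpow_nonneg hosc _
  have hsub := closedBall_subset_of_mem_innerSet hx
  have hcont : Continuous fun y : En n => ‖x - y‖ ^ q / (q * ε ^ (q - 1)) :=
    ((continuous_const.sub continuous_id).norm.rpow_const fun _ => Or.inr hq.le).div_const _
  obtain ⟨y, hy, hmin⟩ := LowerSemicontinuousOn.exists_isMinOn
    ⟨x, mem_closedBall_self hr⟩ (isCompact_closedBall x (rEps u Ω q ε))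
    ((hlsc.mono hsub).add hcont.continuousOn.lowerSemicontinuousOn)
  refine ⟨y, hsub hy, le_antisymm (infConv_le hbddB hq hε (hsub hy) x) ?_⟩
  refine le_csInf (Set.Nonempty.image _ ⟨x, hxΩ⟩) ?_
  rintro _ ⟨z, hz, rfl⟩
  by_cases hzr : z ∈ closedBall x (rEps u Ω q ε)
  · exact hmin hzr
  · have hyx : u y + ‖x - y‖ ^ q / (q * ε ^ (q - 1)) ≤ u x := by
      simpa [Real.zero_rpow hq.ne'] using hmin (mem_closedBall_self (x := x) hr)
    rw [mem_closedBall, not_le, dist_comm, dist_eq_norm] at hzr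
    have hpow : q * ε ^ (q - 1) * (sSup (u '' Ω) - sInf (u '' Ω)) ≤ ‖x - z‖ ^ q := by
      have := Real.rpow_le_rpow hr hzr.le hq.le
      rwa [rEps, ← Real.rpow_mul hosc, one_div, inv_mul_cancel₀ hq.ne', Real.rpow_one] at this
    have hdiv : sSup (u '' Ω) - sInf (u '' Ω) ≤ ‖x - z‖ ^ q / (q * ε ^ (q - 1)) := by
      rw [le_div_iff₀ hc]
      linarith
    have hmz : sInf (u '' Ω) ≤ u z := csInf_le hbddB (mem_image_of_mem _ hz)
    show u y + ‖x - y‖ ^ q / (q * ε ^ (q - 1)) ≤ u z + ‖x - z‖ ^ q / (q * ε ^ (q - 1))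
    linarith

/-- If the infimal convolution has vanishing gradient at `x`, in the sense that its quadratic
difference quotients converge, then `x` is the only minimizer. -/
theorem eq_of_mem_Yset_of_tendsto {n : ℕ} {u : En n → ℝ} {Ω : Set (En n)} {q ε : ℝ}
    (hbddB : BddBelow (u '' Ω)) (hq : 1 ≤ q) (hε : 0 < ε) {x y : En n} (hy : y ∈ Yset u Ω q ε x)
    {l : ℝ} (hl : Tendsto
      (fun t : ℝ => (infConv u Ω q ε (x + t • (y - x)) - infConv u Ω q ε x) / t ^ 2)
      (𝓝[>] 0) (𝓝 l)) : y = x := by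
  by_contra hne
  have hq0 : 0 < q := by linarith
  have hv : 0 < ‖x - y‖ := norm_pos_iff.mpr (sub_ne_zero.mpr (Ne.symm hne))
  have hK : 0 < ‖x - y‖ ^ q / (q * ε ^ (q - 1)) := by positivity
  have ht : Tendsto (fun t : ℝ => t) (𝓝[>] 0) (𝓝 0) := tendsto_id.mono_left nhdsWithin_le_nhds
  have hlim := ht.mul hl
  rw [zero_mul] at hlim
  have : 0 ≤ -(‖x - y‖ ^ q / (q * ε ^ (q - 1))) := by
    refine le_of_tendsto hlim ?_
    filter_upwards [Ioo_mem_nhdsGT (zero_lt_one' ℝ)] with t ht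
    obtain ⟨ht0, ht1⟩ := ht
    have hle := infConv_le hbddB hq0 hε hy.1 (x + t • (y - x))
    have hvec : x + t • (y - x) - y = (1 - t) • (x - y) := by module
    rw [hvec, norm_smul, Real.norm_of_nonneg (by linarith),
      Real.mul_rpow (by linarith) hv.le, mul_div_assoc] at hle
    have hpow : (1 - t) ^ q ≤ 1 - t := by
      simpa using Real.rpow_le_rpow_of_exponent_ge (by linarith) (by linarith : 1 - t ≤ 1) hq
    have hmul := mul_le_mul_of_nonneg_right hpow hK.le
    have heq := hy.2
    have hquot : t * ((infConv u Ω q ε (x + t • (y - x)) - infConv u Ω q ε x) / t ^ 2) =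
        (infConv u Ω q ε (x + t • (y - x)) - infConv u Ω q ε x) / t := by
      field_simp
    rw [hquot, div_le_iff₀ ht0]
    linarith
  linarith

/-- if the infimal convolution has a second-order expansion with vanishing
gradient, its Hessian is negative semidefinite. -/
theorem stmt16
    {n : ℕ} (hn : 1 ≤ n)
    (Ω : Set (En n)) (hΩo : IsOpen Ω) (hΩb : Bornology.IsBounded Ω)
    (u : En n → ℝ)
    (hbddA : BddAbove (u '' Ω)) (hbddB : BddBelow (u '' Ω))
    (hlsc : LowerSemicontinuousOn u Ω)
    (q ε : ℝ) (hq : 2 < q) (hε : 0 < ε)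
    (x₀ : En n) (hx₀ : x₀ ∈ innerSet Ω (rEps u Ω q ε))
    (w : En n) (A : En n →L[ℝ] En n) (hA : IsSelfAdjoint A)
    (hexp : (fun y => infConv u Ω q ε y -
        (infConv u Ω q ε x₀ + ⟪w, y - x₀⟫ + (1 / 2) * ⟪A (y - x₀), y - x₀⟫))
      =o[𝓝 x₀] fun y => ‖y - x₀‖ ^ 2)
    (hw : w = 0) :
    ∀ ξ : En n, ⟪A ξ, ξ⟫ ≤ 0 := by
  intro ξ
  have hq0 : 0 < q := by linarith
  simp only [hw, inner_zero_left, add_zero] at hexp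
  obtain ⟨y, hy⟩ := Yset_nonempty hbddA hbddB hlsc hq0 hε hx₀
  obtain rfl := eq_of_mem_Yset_of_tendsto hbddB (by linarith) hε hy
    (tendsto_quotient_of_expansion hexp (y - x₀))
  have hbound : Tendsto (fun t : ℝ => t ^ (q - 2) * (‖ξ‖ ^ q / (q * ε ^ (q - 1))))
      (𝓝[>] 0) (𝓝 0) := by
    have hcont : ContinuousAt (fun t : ℝ => t ^ (q - 2)) 0 :=
      Real.continuousAt_rpow_const _ _ (Or.inr (by linarith))
    have hlim := (hcont.tendsto.mono_left (nhdsWithin_le_nhds (s := Ioi 0))).mul_const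
      (‖ξ‖ ^ q / (q * ε ^ (q - 1)))
    simpa [Real.zero_rpow (by linarith : q - 2 ≠ 0)] using hlim
  have hle : (1 / 2) * ⟪A ξ, ξ⟫ ≤ 0 := by
    refine le_of_tendsto_of_tendsto (tendsto_quotient_of_expansion hexp ξ) hbound ?_
    filter_upwards [self_mem_nhdsWithin] with t ht
    have ht0 : 0 < t := ht
    have hup := infConv_le hbddB hq0 hε hy.1 (y + t • ξ)
    have heq := hy.2
    rw [sub_self, norm_zero, Real.zero_rpow hq0.ne', zero_div, add_zero] at heq
    rw [add_sub_cancel_left, norm_smul, Real.norm_of_nonneg ht0.le,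
      Real.mul_rpow ht0.le (norm_nonneg _), mul_div_assoc] at hup
    have hpow : t ^ q = t ^ (q - 2) * t ^ 2 := by
      rw [← Real.rpow_natCast t 2, ← Real.rpow_add ht0]
      norm_num
    rw [div_le_iff₀ (by positivity)]
    rw [hpow] at hup
    linarith
  linarith
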